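/- (Maschke-type theorem for entwined modules.) Let (A,C)_ψ be an entwining structure admitting a normalised integral map φ : C → C* ⊗ A. If f : N → M is a morphism of entwined modules that has a section (respectively retraction) as a right A-module map, then f has a section (respectively retraction) in the category of entwined modules; the section is given by g̃(m) = g(m₍₀₎)₍₀₎ · m₍₁₎⁽²⁾ ⟨g(m₍₀₎)₍₁₎, m₍₁₎⁽¹⁾⟩ where φ(c) = c⁽¹⁾ ⊗ c⁽²⁾. -/

import Mathlib

open TensorProduct LinearMap

noncomputable section

variable (k A C : Type*) [CommRing k] [Ring A] [Algebra k A]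
  [AddCommGroup C] [Module k C] [Coalgebra k C]

/-- An entwining structure `(A,C)_ψ` over `k`. -/
structure Entwining where
  psi : C ⊗[k] A →ₗ[k] A ⊗[k] C
  mul_compat :
    psi ∘ₗ lTensor C (LinearMap.mul' k A)
      = rTensor C (LinearMap.mul' k A)
        ∘ₗ (TensorProduct.assoc k A A C).symm.toLinearMap
        ∘ₗ lTensor A psi
        ∘ₗ (TensorProduct.assoc k A C A).toLinearMap
        ∘ₗ rTensor A psi
        ∘ₗ (TensorProduct.assoc k C A A).symm.toLinearMap
  one_compat : ∀ c : C, psi (c ⊗ₜ[k] (1 : A)) = (1 : A) ⊗ₜ[k] c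
  comul_compat :
    lTensor A (Coalgebra.comul (R := k) (A := C)) ∘ₗ psi
      = (TensorProduct.assoc k A C C).toLinearMap
        ∘ₗ rTensor C psi
        ∘ₗ (TensorProduct.assoc k C A C).symm.toLinearMap
        ∘ₗ lTensor C psi
        ∘ₗ (TensorProduct.assoc k C C A).toLinearMap
        ∘ₗ rTensor A (Coalgebra.comul (R := k) (A := C))
  counit_compat : ∀ (c : C) (a : A),
    (TensorProduct.rid k A)
        ((lTensor A (Coalgebra.counit (R := k) (A := C))) (psi (c ⊗ₜ[k] a)))
      = Coalgebra.counit (R := k) c • a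

variable {k A C} in
/-- `act` is a unital associative right `A`-action on `M`. -/
def IsRAction {M : Type*} [AddCommGroup M] [Module k M]
    (act : M ⊗[k] A →ₗ[k] M) : Prop :=
  (∀ m : M, act (m ⊗ₜ[k] (1 : A)) = m) ∧
  act ∘ₗ lTensor M (LinearMap.mul' k A)
    = act ∘ₗ rTensor A act ∘ₗ (TensorProduct.assoc k M A A).symm.toLinearMap

variable {k A C} in
/-- `coact` is a counital coassociative right `C`-coaction on `M`. -/
def IsRCoaction {M : Type*} [AddCommGroup M] [Module k M]
    (coact : M →ₗ[k] M ⊗[k] C) : Prop :=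
  (∀ m : M, (TensorProduct.rid k M)
      ((lTensor M (Coalgebra.counit (R := k) (A := C))) (coact m)) = m) ∧
  rTensor C coact ∘ₗ coact
    = (TensorProduct.assoc k M C C).symm.toLinearMap
      ∘ₗ lTensor M (Coalgebra.comul (R := k) (A := C)) ∘ₗ coact

variable {k A C} in
/-- The compatibility condition making `(M, act, coact)` an entwined
`(A,C)_ψ`-module: `ρ^M(m·a) = m₍₀₎·a_α ⊗ m₍₁₎^α`. -/
def IsEntwinedModule (E : Entwining k A C) {M : Type*} [AddCommGroup M] [Module k M]
    (act : M ⊗[k] A →ₗ[k] M) (coact : M →ₗ[k] M ⊗[k] C) : Prop :=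
  IsRAction act ∧ IsRCoaction coact ∧
  coact ∘ₗ act
    = rTensor C act
      ∘ₗ (TensorProduct.assoc k M A C).symm.toLinearMap
      ∘ₗ lTensor M E.psi
      ∘ₗ (TensorProduct.assoc k M C A).toLinearMap
      ∘ₗ rTensor A coact

variable {k A C} in
/-- A morphism of entwined modules: right `A`-linear and right `C`-colinear. -/
def IsEntwinedHom {M N : Type*} [AddCommGroup M] [Module k M]
    [AddCommGroup N] [Module k N]
    (actM : M ⊗[k] A →ₗ[k] M) (coactM : M →ₗ[k] M ⊗[k] C)
    (actN : N ⊗[k] A →ₗ[k] N) (coactN : N →ₗ[k] N ⊗[k] C)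
    (f : M →ₗ[k] N) : Prop :=
  (f ∘ₗ actM = actN ∘ₗ rTensor A f) ∧ (coactN ∘ₗ f = rTensor C f ∘ₗ coactM)

variable {k C} in
/-- The evaluation pairing `C ⊗ C* → k`. -/
def pairCD : C ⊗[k] Module.Dual k C →ₗ[k] k :=
  TensorProduct.lift (Module.Dual.eval k C)

variable {k A C} in
/-- `φ : C → C* ⊗ A` is a normalised integral map in `(A,C)_ψ`
(Definition 4.1 of the paper). -/
def IsNormalisedIntegralMap (E : Entwining k A C)
    (φ : C →ₗ[k] Module.Dual k C ⊗[k] A) : Prop :=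
  -- (1) `μ∘(A⊗ev_C⊗A)∘(ψ⊗φ)∘(C⊗ψ) = (ev_C⊗μ)∘(C⊗φ⊗A)`
  ((LinearMap.mul' k A)
    ∘ₗ lTensor A (TensorProduct.lid k A).toLinearMap
    ∘ₗ lTensor A (rTensor A (pairCD (k := k) (C := C)))
    ∘ₗ lTensor A (TensorProduct.assoc k C (Module.Dual k C) A).symm.toLinearMap
    ∘ₗ (TensorProduct.assoc k A C (Module.Dual k C ⊗[k] A)).toLinearMap
    ∘ₗ TensorProduct.map E.psi φ
    ∘ₗ (TensorProduct.assoc k C A C).symm.toLinearMap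
    ∘ₗ lTensor C E.psi
    = (TensorProduct.lid k A).toLinearMap
      ∘ₗ TensorProduct.map (pairCD (k := k) (C := C)) (LinearMap.mul' k A)
      ∘ₗ (TensorProduct.assoc k C (Module.Dual k C) (A ⊗[k] A)).symm.toLinearMap
      ∘ₗ lTensor C (TensorProduct.assoc k (Module.Dual k C) A A).toLinearMap
      ∘ₗ lTensor C (rTensor A φ)) ∧
  -- (2) `(ev_C⊗A⊗C)∘(C⊗φ⊗C)∘(C⊗Δ) = ψ∘(C⊗ev_C⊗A)∘(Δ⊗φ)`
  ((TensorProduct.lid k (A ⊗[k] C)).toLinearMap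
    ∘ₗ rTensor (A ⊗[k] C) (pairCD (k := k) (C := C))
    ∘ₗ (TensorProduct.assoc k C (Module.Dual k C) (A ⊗[k] C)).symm.toLinearMap
    ∘ₗ lTensor C (TensorProduct.assoc k (Module.Dual k C) A C).toLinearMap
    ∘ₗ lTensor C (rTensor C φ)
    ∘ₗ lTensor C (Coalgebra.comul (R := k) (A := C))
    = E.psi
      ∘ₗ lTensor C (TensorProduct.lid k A).toLinearMap
      ∘ₗ lTensor C (rTensor A (pairCD (k := k) (C := C)))
      ∘ₗ lTensor C (TensorProduct.assoc k C (Module.Dual k C) A).symm.toLinearMap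
      ∘ₗ (TensorProduct.assoc k C C (Module.Dual k C ⊗[k] A)).toLinearMap
      ∘ₗ TensorProduct.map (Coalgebra.comul (R := k) (A := C)) φ) ∧
  -- (3) `(ev_C⊗A)∘(C⊗φ)∘Δ = 1_A ∘ ε`
  ((TensorProduct.lid k A).toLinearMap
    ∘ₗ rTensor A (pairCD (k := k) (C := C))
    ∘ₗ (TensorProduct.assoc k C (Module.Dual k C) A).symm.toLinearMap
    ∘ₗ lTensor C φ
    ∘ₗ (Coalgebra.comul (R := k) (A := C))
    = (Algebra.linearMap k A) ∘ₗ (Coalgebra.counit (R := k) (A := C)))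

variable {k A C} in
/-- The averaged map `g̃ : M → N`,
`g̃(m) = g(m₍₀₎)₍₀₎ · m₍₁₎⁽²⁾ ⟨g(m₍₀₎)₍₁₎, m₍₁₎⁽¹⁾⟩` (Lemma 4.3). -/
def intAvg (φ : C →ₗ[k] Module.Dual k C ⊗[k] A)
    {M N : Type*} [AddCommGroup M] [Module k M] [AddCommGroup N] [Module k N]
    (actN : N ⊗[k] A →ₗ[k] N) (coactN : N →ₗ[k] N ⊗[k] C)
    (coactM : M →ₗ[k] M ⊗[k] C) (g : M →ₗ[k] N) : M →ₗ[k] N :=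
  actN
  ∘ₗ lTensor N (TensorProduct.lid k A).toLinearMap
  ∘ₗ lTensor N (rTensor A (pairCD (k := k) (C := C)))
  ∘ₗ lTensor N (TensorProduct.assoc k C (Module.Dual k C) A).symm.toLinearMap
  ∘ₗ (TensorProduct.assoc k N C (Module.Dual k C ⊗[k] A)).toLinearMap
  ∘ₗ TensorProduct.map (coactN ∘ₗ g) φ
  ∘ₗ coactM

namespace MaschkeAux
variable {k A C}

/-- `θ(d ⊗ c) = ⟨d, c⁽¹⁾⟩ c⁽²⁾`. -/
def theta (φ : C →ₗ[k] Module.Dual k C ⊗[k] A) : C ⊗[k] C →ₗ[k] A :=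
  (TensorProduct.lid k A).toLinearMap
  ∘ₗ rTensor A (pairCD (k := k) (C := C))
  ∘ₗ (TensorProduct.assoc k C (Module.Dual k C) A).symm.toLinearMap
  ∘ₗ lTensor C φ

/-- `T(n ⊗ d ⊗ c) = n · θ(d ⊗ c)`. -/
def T (φ : C →ₗ[k] Module.Dual k C ⊗[k] A) {N : Type*} [AddCommGroup N] [Module k N]
    (actN : N ⊗[k] A →ₗ[k] N) : (N ⊗[k] C) ⊗[k] C →ₗ[k] N :=
  actN ∘ₗ lTensor N (theta φ) ∘ₗ (TensorProduct.assoc k N C C).toLinearMap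

lemma T_tmul (φ : C →ₗ[k] Module.Dual k C ⊗[k] A) {N : Type*} [AddCommGroup N] [Module k N]
    (actN : N ⊗[k] A →ₗ[k] N) (n : N) (c d : C) :
    T φ actN ((n ⊗ₜ c) ⊗ₜ d) = actN (n ⊗ₜ theta φ (c ⊗ₜ d)) := by
  simp [T]

lemma intAvg_eq (φ : C →ₗ[k] Module.Dual k C ⊗[k] A)
    {M N : Type*} [AddCommGroup M] [Module k M] [AddCommGroup N] [Module k N]
    (actN : N ⊗[k] A →ₗ[k] N) (coactN : N →ₗ[k] N ⊗[k] C)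
    (coactM : M →ₗ[k] M ⊗[k] C) (g : M →ₗ[k] N) :
    intAvg φ actN coactN coactM g
      = T φ actN ∘ₗ rTensor C (coactN ∘ₗ g) ∘ₗ coactM := by
  have h : actN
      ∘ₗ lTensor N (TensorProduct.lid k A).toLinearMap
      ∘ₗ lTensor N (rTensor A (pairCD (k := k) (C := C)))
      ∘ₗ lTensor N (TensorProduct.assoc k C (Module.Dual k C) A).symm.toLinearMap
      ∘ₗ (TensorProduct.assoc k N C (Module.Dual k C ⊗[k] A)).toLinearMap
      ∘ₗ lTensor (N ⊗[k] C) φ = T φ actN := by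
    ext n c d
    simp [T, theta]
  rw [← h]
  ext m
  simp only [intAvg, LinearMap.comp_apply]
  generalize coactM m = x
  induction x with
  | zero => simp
  | add x y hx hy => simp only [map_add, hx, hy]
  | tmul x y => simp

section
variable {E : Entwining k A C} {φ : C →ₗ[k] Module.Dual k C ⊗[k] A}

/-- (1) -/
lemma int1 (hφ : IsNormalisedIntegralMap E φ)
    (c d : C) (a : A) :
    (LinearMap.mul' k A ∘ₗ lTensor A (theta φ) ∘ₗ (TensorProduct.assoc k A C C).toLinearMap
      ∘ₗ rTensor C E.psi ∘ₗ (TensorProduct.assoc k C A C).symm.toLinearMap)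
      (c ⊗ₜ E.psi (d ⊗ₜ a)) = theta φ (c ⊗ₜ d) * a := by
  have h := LinearMap.congr_fun hφ.1 (c ⊗ₜ (d ⊗ₜ a))
  have e2 : theta φ (c ⊗ₜ d) * a = ((TensorProduct.lid k A).toLinearMap
      ∘ₗ TensorProduct.map (pairCD (k := k) (C := C)) (LinearMap.mul' k A)
      ∘ₗ (TensorProduct.assoc k C (Module.Dual k C) (A ⊗[k] A)).symm.toLinearMap
      ∘ₗ lTensor C (TensorProduct.assoc k (Module.Dual k C) A A).toLinearMap
      ∘ₗ lTensor C (rTensor A φ)) (c ⊗ₜ (d ⊗ₜ a)) := by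
    simp only [theta, LinearMap.comp_apply, lTensor_tmul, rTensor_tmul]
    generalize φ d = x
    induction x with
    | zero => simp
    | add x y hx hy => simp only [map_add, tmul_add, add_tmul, add_mul, hx, hy]
    | tmul x y => simp
  rw [e2, ← h]
  simp only [LinearMap.comp_apply, lTensor_tmul]
  generalize E.psi (d ⊗ₜ a) = x
  induction x with
  | zero => simp
  | add x y hx hy => simp only [map_add, tmul_add, hx, hy]
  | tmul b e =>
    simp only [LinearEquiv.coe_coe, assoc_symm_tmul, rTensor_tmul, map_tmul]
    generalize E.psi (c ⊗ₜ b) = x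
    induction x with
    | zero => simp
    | add x y hx hy => simp only [map_add, add_tmul, hx, hy]
    | tmul x y => simp [theta]

/-- (2) -/
lemma int2 (hφ : IsNormalisedIntegralMap E φ)
    (c d : C) :
    (rTensor C (theta φ) ∘ₗ (TensorProduct.assoc k C C C).symm.toLinearMap)
      (c ⊗ₜ Coalgebra.comul (R := k) d)
    = (E.psi ∘ₗ lTensor C (theta φ) ∘ₗ (TensorProduct.assoc k C C C).toLinearMap)
      (Coalgebra.comul (R := k) c ⊗ₜ d) := by
  have h := LinearMap.congr_fun hφ.2.1 (c ⊗ₜ d)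
  have e1 : (E.psi ∘ₗ lTensor C (theta φ) ∘ₗ (TensorProduct.assoc k C C C).toLinearMap)
      (Coalgebra.comul (R := k) c ⊗ₜ d) = (E.psi
      ∘ₗ lTensor C (TensorProduct.lid k A).toLinearMap
      ∘ₗ lTensor C (rTensor A (pairCD (k := k) (C := C)))
      ∘ₗ lTensor C (TensorProduct.assoc k C (Module.Dual k C) A).symm.toLinearMap
      ∘ₗ (TensorProduct.assoc k C C (Module.Dual k C ⊗[k] A)).toLinearMap
      ∘ₗ TensorProduct.map (Coalgebra.comul (R := k) (A := C)) φ) (c ⊗ₜ d) := by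
    simp only [LinearMap.comp_apply, map_tmul]
    generalize Coalgebra.comul (R := k) c = x
    induction x with
    | zero => simp
    | add x y hx hy => simp only [map_add, add_tmul, hx, hy]
    | tmul x y => simp [theta]
  rw [e1, ← h]
  simp only [LinearMap.comp_apply, lTensor_tmul]
  generalize Coalgebra.comul (R := k) d = x
  induction x with
  | zero => simp
  | add x y hx hy => simp only [map_add, tmul_add, hx, hy]
  | tmul x y =>
    simp only [LinearEquiv.coe_coe, assoc_symm_tmul, rTensor_tmul, theta, LinearMap.comp_apply,
      lTensor_tmul]
    generalize φ x = z
    induction z with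
    | zero => simp
    | add x y hx hy => simp only [map_add, tmul_add, add_tmul, hx, hy]
    | tmul x y => simp only [LinearEquiv.coe_coe, assoc_symm_tmul, assoc_tmul, rTensor_tmul, lid_tmul, smul_tmul',
      LinearEquiv.coe_coe]

/-- (3) -/
lemma int3 (hφ : IsNormalisedIntegralMap E φ)
    (c : C) : theta φ (Coalgebra.comul (R := k) c)
    = Coalgebra.counit (R := k) c • (1 : A) := by
  have h := LinearMap.congr_fun hφ.2.2 c
  simp only [LinearMap.comp_apply, Algebra.linearMap_apply, Algebra.algebraMap_eq_smul_one] at h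
  rw [← h]; rfl

variable {M N : Type*} [AddCommGroup M] [Module k M] [AddCommGroup N] [Module k N]
    {actM : M ⊗[k] A →ₗ[k] M} {coactM : M →ₗ[k] M ⊗[k] C}
    {actN : N ⊗[k] A →ₗ[k] N} {coactN : N →ₗ[k] N ⊗[k] C}

lemma T_map (f : N →ₗ[k] M) (hf : f ∘ₗ actN = actM ∘ₗ rTensor A f) :
    f ∘ₗ T φ actN = T φ actM ∘ₗ rTensor C (rTensor C f) := by
  ext n c d
  have := LinearMap.congr_fun hf (n ⊗ₜ theta φ (c ⊗ₜ d))
  simpa [T] using this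

/-- normalisation: `m₀ θ(m₁ ⊗ m₂) = m`. -/
lemma T_norm (hφ : IsNormalisedIntegralMap E φ)
    (hM : IsEntwinedModule E actM coactM) (m : M) :
    T φ actM (rTensor C coactM (coactM m)) = m := by
  have h := LinearMap.congr_fun hM.2.1.2 m
  simp only [LinearMap.comp_apply] at h
  rw [h]
  conv_rhs => rw [← hM.2.1.1 m]
  generalize coactM m = x
  induction x with
  | zero => simp
  | add x y hx hy => simp only [map_add, hx, hy]
  | tmul x y => simp [T, int3 hφ, hM.1.1]

lemma lin (hφ : IsNormalisedIntegralMap E φ)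
    (hM : IsEntwinedModule E actM coactM) (hN : IsEntwinedModule E actN coactN)
    (g : M →ₗ[k] N) (hg : g ∘ₗ actM = actN ∘ₗ rTensor A g) :
    intAvg φ actN coactN coactM g ∘ₗ actM
      = actN ∘ₗ rTensor A (intAvg φ actN coactN coactM g) := by
  rw [intAvg_eq]
  apply TensorProduct.ext'
  intro m a
  have h := LinearMap.congr_fun hM.2.2 (m ⊗ₜ a)
  simp only [LinearMap.comp_apply, rTensor_tmul] at h ⊢
  rw [h]
  generalize coactM m = x
  induction x with
  | zero => simp
  | add x y hx hy => simp only [map_add, add_tmul, hx, hy]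
  | tmul m c =>
    simp only [LinearEquiv.coe_coe, assoc_tmul, lTensor_tmul, rTensor_tmul, LinearMap.comp_apply]
    -- push the action inside
    have key : ∀ y : A ⊗[k] C, T φ actN (rTensor C (coactN ∘ₗ g) (rTensor C actM
        ((TensorProduct.assoc k M A C).symm (m ⊗ₜ y))))
        = T φ actN (rTensor C (rTensor C actN
            ∘ₗ (TensorProduct.assoc k N A C).symm.toLinearMap
            ∘ₗ lTensor N E.psi
            ∘ₗ (TensorProduct.assoc k N C A).toLinearMap)
          ((TensorProduct.assoc k (N ⊗[k] C) A C).symm (coactN (g m) ⊗ₜ y))) := by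
      intro y
      induction y with
      | zero => simp
      | add x y hx hy => simp only [map_add, tmul_add, hx, hy]
      | tmul b e =>
        have h1 := LinearMap.congr_fun hg (m ⊗ₜ b)
        have h2 := LinearMap.congr_fun hN.2.2 (g m ⊗ₜ b)
        simp only [LinearMap.comp_apply, rTensor_tmul] at h1 h2
        simp only [assoc_symm_tmul, rTensor_tmul, LinearMap.comp_apply, h1, h2]
    rw [key]
    generalize coactN (g m) = z
    induction z with
    | zero => simp
    | add x y hx hy => simp only [map_add, add_tmul, hx, hy]
    | tmul n d =>
      have h3 := LinearMap.congr_fun hN.1.2 (n ⊗ₜ (theta φ (d ⊗ₜ c) ⊗ₜ a))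
      simp only [LinearMap.comp_apply, rTensor_tmul, lTensor_tmul, LinearEquiv.coe_coe,
        assoc_symm_tmul, mul'_apply] at h3
      rw [T_tmul, ← h3, ← int1 hφ]
      generalize E.psi (c ⊗ₜ a) = y
      induction y with
      | zero => simp
      | add x y hx hy => simp only [map_add, tmul_add, hx, hy]
      | tmul b e =>
        simp only [assoc_symm_tmul, rTensor_tmul, LinearMap.comp_apply, LinearEquiv.coe_coe,
          assoc_tmul, lTensor_tmul]
        generalize E.psi (d ⊗ₜ b) = y
        induction y with
        | zero => simp
        | add x y hx hy => simp only [map_add, tmul_add, add_tmul, hx, hy]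
        | tmul b1 e1 =>
          have h4 := LinearMap.congr_fun hN.1.2 (n ⊗ₜ (b1 ⊗ₜ theta φ (e1 ⊗ₜ e)))
          simp only [LinearMap.comp_apply, rTensor_tmul, lTensor_tmul, LinearEquiv.coe_coe,
            assoc_symm_tmul, mul'_apply] at h4
          simp [T_tmul, h4]

lemma colin (hφ : IsNormalisedIntegralMap E φ)
    (hM : IsEntwinedModule E actM coactM) (hN : IsEntwinedModule E actN coactN)
    (g : M →ₗ[k] N) :
    coactN ∘ₗ intAvg φ actN coactN coactM g
      = rTensor C (intAvg φ actN coactN coactM g) ∘ₗ coactM := by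
  rw [intAvg_eq]
  ext m
  have h := LinearMap.congr_fun hM.2.1.2 m
  rw [rTensor_comp C (T φ actN), rTensor_comp C (rTensor C (coactN ∘ₗ g))]
  simp only [LinearMap.comp_apply] at h ⊢
  rw [h]
  generalize coactM m = x
  induction x with
  | zero => simp
  | add x y hx hy => simp only [map_add, hx, hy]
  | tmul m c =>
    simp only [LinearEquiv.coe_coe, lTensor_tmul, rTensor_tmul, LinearMap.comp_apply]
    have hl : ∀ n : N, coactN (T φ actN (coactN n ⊗ₜ c)) =
        rTensor C actN ((TensorProduct.assoc k N A C).symm (lTensor N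
          (E.psi ∘ₗ lTensor C (theta φ) ∘ₗ (TensorProduct.assoc k C C C).toLinearMap ∘ₗ
            (TensorProduct.mk k (C ⊗[k] C) C).flip c)
          (TensorProduct.assoc k N C C (rTensor C coactN (coactN n))))) := by
      intro n
      generalize coactN n = x
      induction x with
      | zero => simp
      | add x y hx hy => simp only [map_add, add_tmul, hx, hy]
      | tmul n d =>
        have h2 := LinearMap.congr_fun hN.2.2 (n ⊗ₜ theta φ (d ⊗ₜ c))
        simp only [LinearMap.comp_apply, rTensor_tmul] at h2
        rw [T_tmul, h2, rTensor_tmul]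
        generalize coactN n = z
        induction z with
        | zero => simp
        | add x y hx hy => simp only [map_add, add_tmul, hx, hy]
        | tmul n e => simp
    have h3 := LinearMap.congr_fun hN.2.1.2 (g m)
    simp only [LinearMap.comp_apply] at h3
    rw [hl, h3, LinearEquiv.coe_coe, LinearEquiv.apply_symm_apply]
    have hr : ∀ y : C ⊗[k] C, rTensor C (T φ actN) (rTensor C (rTensor C (coactN ∘ₗ g))
        ((TensorProduct.assoc k M C C).symm (m ⊗ₜ y))) =
        rTensor C (T φ actN) ((TensorProduct.assoc k (N ⊗[k] C) C C).symm
          (coactN (g m) ⊗ₜ y)) := by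
      intro y
      induction y with
      | zero => simp
      | add x y hx hy => simp only [map_add, tmul_add, hx, hy]
      | tmul b e => simp
    rw [hr]
    generalize coactN (g m) = z
    induction z with
    | zero => simp
    | add x y hx hy => simp only [map_add, add_tmul, hx, hy]
    | tmul n d =>
      have h5 := int2 hφ d c
      simp only [LinearMap.comp_apply] at h5
      simp only [lTensor_tmul, LinearMap.comp_apply, flip_apply, mk_apply]
      rw [← h5]
      generalize Coalgebra.comul (R := k) c = y
      induction y with
      | zero => simp
      | add x y hx hy => simp only [map_add, tmul_add, hx, hy]
      | tmul b e => simp [T_tmul]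
end
end MaschkeAux

/-- Maschke-type theorem for entwined modules: if `(A,C)_ψ`
admits a normalised integral map, then a morphism of entwined modules with a
section (resp. retraction) as right `A`-module map has a section
(resp. retraction) in the category of entwined modules, namely `g̃`. -/
theorem maschke_entwined (E : Entwining k A C)
    (φ : C →ₗ[k] Module.Dual k C ⊗[k] A) (hφ : IsNormalisedIntegralMap E φ)
    (M N : Type*) [AddCommGroup M] [Module k M] [AddCommGroup N] [Module k N]
    (actM : M ⊗[k] A →ₗ[k] M) (coactM : M →ₗ[k] M ⊗[k] C)
    (actN : N ⊗[k] A →ₗ[k] N) (coactN : N →ₗ[k] N ⊗[k] C)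
    (hM : IsEntwinedModule E actM coactM) (hN : IsEntwinedModule E actN coactN)
    (f : N →ₗ[k] M) (hf : IsEntwinedHom actN coactN actM coactM f) :
    -- section case
    (∀ g : M →ₗ[k] N,
      (g ∘ₗ actM = actN ∘ₗ rTensor A g) →  -- `g` is right `A`-linear
      f ∘ₗ g = LinearMap.id →               -- `g` is a section of `f` in `M_A`
      IsEntwinedHom actM coactM actN coactN (intAvg φ actN coactN coactM g) ∧
      f ∘ₗ intAvg φ actN coactN coactM g = LinearMap.id) ∧
    -- retraction case
    (∀ g : M →ₗ[k] N,
      (g ∘ₗ actM = actN ∘ₗ rTensor A g) →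
      g ∘ₗ f = LinearMap.id →               -- `g` is a retraction of `f` in `M_A`
      IsEntwinedHom actM coactM actN coactN (intAvg φ actN coactN coactM g) ∧
      intAvg φ actN coactN coactM g ∘ₗ f = LinearMap.id) := by
  refine ⟨fun g hg hfg => ⟨⟨MaschkeAux.lin hφ hM hN g hg, MaschkeAux.colin hφ hM hN g⟩, ?_⟩,
    fun g hg hgf => ⟨⟨MaschkeAux.lin hφ hM hN g hg, MaschkeAux.colin hφ hM hN g⟩, ?_⟩⟩
  · rw [MaschkeAux.intAvg_eq, ← LinearMap.comp_assoc, MaschkeAux.T_map f hf.1,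
      LinearMap.comp_assoc, ← LinearMap.comp_assoc coactM,
      ← rTensor_comp, ← LinearMap.comp_assoc g, ← hf.2, LinearMap.comp_assoc g, hfg]
    ext m
    simpa using MaschkeAux.T_norm hφ hM m
  · rw [MaschkeAux.intAvg_eq, LinearMap.comp_assoc, LinearMap.comp_assoc, hf.2,
      ← LinearMap.comp_assoc coactN (rTensor C f), ← rTensor_comp, LinearMap.comp_assoc f, hgf]
    ext n
    simpa using MaschkeAux.T_norm hφ hN n
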